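/- (Differentiation formula (34).) Let n ≥ 1, let a, b_1,…,b_n, c_1,…,c_n be real with no c_k a nonpositive integer, and fix 1 ≤ i ≤ n. On the open region {z ∈ ℝ^n : |z_1|+⋯+|z_n| < 1}, the function z ↦ F_A^(n)(a; b_1,…,b_n; c_1,…,c_n; z) is partially differentiable in z_i and ∂/∂z_i F_A^(n)(a; b_1,…,b_n; c_1,…,c_n; z) = (a b_i / c_i) · F_A^(n)(a+1; b_1,…,b_{i−1}, b_i+1, b_{i+1},…,b_n; c_1,…,c_{i−1}, c_i+1, c_{i+1},…,c_n; z). -/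

import Mathlib

open Finset Real Filter

/-- Pochhammer symbol `(μ)_p = μ(μ+1)⋯(μ+p−1)`. -/
noncomputable def poch (μ : ℝ) (p : ℕ) : ℝ := (ascPochhammer ℝ p).eval μ

/-- `x` is not a nonpositive integer. -/
def NotNonposInt (x : ℝ) : Prop := ∀ j : ℕ, x ≠ -(j : ℝ)

/-- Gauss hypergeometric series `F(a,b;c;z) = Σ_p (a)_p (b)_p z^p / (p! (c)_p)`. -/
noncomputable def gaussF (a b c z : ℝ) : ℝ :=
  ∑' p : ℕ, poch a p * poch b p / ((Nat.factorial p : ℝ) * poch c p) * z ^ p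

/-- General term of the Lauricella hypergeometric series `F_A^(n)`. -/
noncomputable def lauricellaTerm {n : ℕ} (a : ℝ) (b c z : Fin n → ℝ) (p : Fin n → ℕ) : ℝ :=
  poch a (∑ k, p k) *
    ∏ k, poch (b k) (p k) / poch (c k) (p k) * z k ^ p k / (Nat.factorial (p k) : ℝ)

/-- Lauricella hypergeometric series `F_A^(n)(a; b; c; z)`. -/
noncomputable def lauricella {n : ℕ} (a : ℝ) (b c z : Fin n → ℝ) : ℝ :=
  ∑' p : Fin n → ℕ, lauricellaTerm a b c z p

theorem poch_succ (μ : ℝ) (p : ℕ) : poch μ (p + 1) = poch μ p * (μ + p) := by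
  simp [poch, ascPochhammer_succ_eval]

theorem poch_succ_left (μ : ℝ) (p : ℕ) : poch μ (p + 1) = μ * poch (μ + 1) p := by
  simp [poch, ascPochhammer_succ_left, Polynomial.eval_comp]

theorem poch_one (p : ℕ) : poch 1 p = (p.factorial : ℝ) := by
  simp [poch]

theorem tendsto_add_natCast_div_add_natCast (b c : ℝ) :
    Tendsto (fun p : ℕ => (b + p) / (c + p)) atTop (nhds 1) := by
  have hb := (tendsto_const_div_atTop_nhds_zero_nat b).add_const 1
  have hc := (tendsto_const_div_atTop_nhds_zero_nat c).add_const 1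
  have h := hb.div hc (by norm_num)
  norm_num at h
  refine h.congr' ?_
  filter_upwards [eventually_gt_atTop 0] with p hp
  have hp' : (p : ℝ) ≠ 0 := by positivity
  simp only [Pi.div_apply]
  rw [← div_self hp', ← add_div, ← add_div, div_div_div_cancel_right₀ hp']

/-- A ratio of Pochhammer symbols grows more slowly than any geometric sequence of ratio `σ > 1`. -/
theorem exists_abs_poch_div_poch_le (b c : ℝ) {σ : ℝ} (hσ : 1 < σ) :
    ∃ C : ℝ, 0 ≤ C ∧ ∀ p : ℕ, |poch b p / poch c p| ≤ C * σ ^ p := by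
  have hσ0 : 0 < σ := by linarith
  obtain ⟨r, hr1, hr⟩ := exists_between hσ
  have hsum : Summable fun p : ℕ => poch b p / poch c p / σ ^ p := by
    refine summable_of_ratio_norm_eventually_le (r := r / σ) ((div_lt_one hσ0).2 hr) ?_
    have hlim := (tendsto_add_natCast_div_add_natCast b c).abs
    rw [abs_one] at hlim
    filter_upwards [hlim.eventually (ge_mem_nhds hr1)] with p hp
    have hfac : poch b (p + 1) / poch c (p + 1) / σ ^ (p + 1) =
        (b + p) / (c + p) / σ * (poch b p / poch c p / σ ^ p) := by
      rw [poch_succ, poch_succ, pow_succ]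
      simp only [div_eq_mul_inv, mul_inv]
      ring
    rw [hfac, norm_mul]
    refine mul_le_mul_of_nonneg_right ?_ (norm_nonneg _)
    rw [norm_div, Real.norm_eq_abs, Real.norm_of_nonneg hσ0.le]
    gcongr
  refine ⟨∑' p : ℕ, ‖poch b p / poch c p / σ ^ p‖, tsum_nonneg fun _ => norm_nonneg _, fun p => ?_⟩
  have h := hsum.norm.le_tsum p fun _ _ => norm_nonneg _
  rwa [norm_div, Real.norm_eq_abs, Real.norm_of_nonneg (pow_nonneg hσ0.le p),
    div_le_iff₀ (pow_pos hσ0 p)] at h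

theorem summable_multinomial_mul_prod_pow {ι : Type*} [Fintype ι] [DecidableEq ι] {x : ι → ℝ}
    (hx : ∀ k, 0 ≤ x k) (hx1 : ∑ k, x k < 1) :
    Summable fun p : ι → ℕ => (Nat.multinomial univ p : ℝ) * ∏ k, x k ^ p k := by
  have hnonneg : ∀ p : ι → ℕ, 0 ≤ (Nat.multinomial univ p : ℝ) * ∏ k, x k ^ p k := fun p =>
    mul_nonneg (Nat.cast_nonneg _) (prod_nonneg fun k _ => pow_nonneg (hx k) _)
  have hS : 0 ≤ ∑ k, x k := sum_nonneg fun k _ => hx k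
  refine summable_of_sum_le (c := ∑' N : ℕ, (∑ k, x k) ^ N) hnonneg fun u => ?_
  calc ∑ p ∈ u, (Nat.multinomial univ p : ℝ) * ∏ k, x k ^ p k
      = ∑ N ∈ u.image fun p => ∑ k, p k, ∑ p ∈ u with ∑ k, p k = N,
          (Nat.multinomial univ p : ℝ) * ∏ k, x k ^ p k :=
        (sum_fiberwise_of_maps_to (fun p hp => mem_image_of_mem _ hp) _).symm
    _ ≤ ∑ N ∈ u.image fun p => ∑ k, p k, (∑ k, x k) ^ N := by
        refine sum_le_sum fun N _ => ?_
        rw [sum_pow_eq_sum_piAntidiag]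
        refine sum_le_sum_of_subset_of_nonneg (fun p hp => ?_) fun p _ _ => hnonneg p
        simp [(mem_filter.1 hp).2]
    _ ≤ ∑' N : ℕ, (∑ k, x k) ^ N :=
        (summable_geometric_of_lt_one hS hx1).sum_le_tsum _ fun N _ => pow_nonneg hS N

theorem lauricellaTerm_eq_multinomial {n : ℕ} (a : ℝ) (b c z : Fin n → ℝ) (p : Fin n → ℕ) :
    lauricellaTerm a b c z p = poch a (∑ k, p k) / poch 1 (∑ k, p k) *
      (Nat.multinomial univ p * ∏ k, poch (b k) (p k) / poch (c k) (p k) * z k ^ p k) := by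
  have hm : (∏ k, ((p k).factorial : ℝ)) * Nat.multinomial univ p = (∑ k, p k).factorial := by
    exact_mod_cast Nat.multinomial_spec univ p
  have hp : ∏ k, ((p k).factorial : ℝ) ≠ 0 :=
    prod_ne_zero_iff.2 fun k _ => Nat.cast_ne_zero.2 (Nat.factorial_ne_zero _)
  have hN : ((∑ k, p k).factorial : ℝ) ≠ 0 := Nat.cast_ne_zero.2 (Nat.factorial_ne_zero _)
  rw [lauricellaTerm, prod_div_distrib, poch_one]
  field_simp
  rw [← hm]
  ring

theorem summable_lauricellaTerm {n : ℕ} (a : ℝ) (b c : Fin n → ℝ) {z : Fin n → ℝ}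
    (hz : ∑ k, |z k| < 1) :
    Summable (lauricellaTerm a b c z) := by
  obtain ⟨σ, hσ, hσz⟩ : ∃ σ : ℝ, 1 < σ ∧ σ * σ * ∑ k, |z k| < 1 := by
    have hlim : Tendsto (fun σ : ℝ => σ * σ * ∑ k, |z k|) (nhdsWithin 1 (Set.Ioi 1))
        (nhds (1 * 1 * ∑ k, |z k|)) :=
      (Continuous.tendsto (by fun_prop) 1).mono_left nhdsWithin_le_nhds
    obtain ⟨σ, h, hσ⟩ := ((hlim.eventually (gt_mem_nhds (by simpa using hz))).and
      self_mem_nhdsWithin).exists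
    exact ⟨σ, hσ, h⟩
  have hσ0 : 0 ≤ σ := by linarith
  obtain ⟨A, hA0, hA⟩ := exists_abs_poch_div_poch_le a 1 hσ
  choose C hC0 hC using fun k => exists_abs_poch_div_poch_le (b k) (c k) hσ
  have hsum := (summable_multinomial_mul_prod_pow (x := fun k => σ * σ * |z k|)
    (fun k => by positivity) (by rwa [← mul_sum])).mul_left (A * ∏ k, C k)
  refine Summable.of_norm_bounded hsum fun p => ?_
  rw [lauricellaTerm_eq_multinomial, Real.norm_eq_abs, abs_mul, abs_mul, abs_prod, Nat.abs_cast]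
  calc _ ≤ A * σ ^ (∑ k, p k) * (Nat.multinomial univ p *
        ∏ k, C k * σ ^ p k * |z k| ^ p k) := by
        refine mul_le_mul (hA _) ?_ (by positivity) (by positivity)
        refine mul_le_mul_of_nonneg_left ?_ (Nat.cast_nonneg _)
        refine prod_le_prod (fun _ _ => abs_nonneg _) fun k _ => ?_
        rw [abs_mul, abs_pow]
        exact mul_le_mul_of_nonneg_right (hC k _) (by positivity)
    _ = _ := by
        simp only [prod_mul_distrib, mul_pow, ← prod_pow_eq_pow_sum]
        ring

theorem lauricellaTerm_update {n : ℕ} (a : ℝ) (b c z : Fin n → ℝ) (i : Fin n) (t : ℝ)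
    (p : Fin n → ℕ) :
    lauricellaTerm a b c (Function.update z i t) p =
      lauricellaTerm a b c (Function.update z i 1) p * t ^ p i := by
  have herase : ∀ s : ℝ, ∏ k ∈ univ.erase i, poch (b k) (p k) / poch (c k) (p k) *
      Function.update z i s k ^ p k / ((p k).factorial : ℝ) =
      ∏ k ∈ univ.erase i, poch (b k) (p k) / poch (c k) (p k) * z k ^ p k /
        ((p k).factorial : ℝ) := fun s =>
    prod_congr rfl fun k hk => by rw [Function.update_of_ne (ne_of_mem_erase hk)]
  rw [lauricellaTerm, lauricellaTerm, ← mul_prod_erase _ _ (mem_univ i),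
    ← mul_prod_erase _ _ (mem_univ i), herase, herase, Function.update_self,
    Function.update_self, one_pow]
  ring

/-- Differentiating the term of index `q + e_i` in `z_i` gives the term of index `q` of the series
with shifted parameters. -/
theorem lauricellaTerm_add_single {n : ℕ} (a : ℝ) (b c z : Fin n → ℝ) (i : Fin n) (t : ℝ)
    (q : Fin n → ℕ) :
    lauricellaTerm a b c (Function.update z i 1) (q + Pi.single i 1) *
        (((q + Pi.single i 1 : Fin n → ℕ) i : ℕ) * t ^ ((q + Pi.single i 1 : Fin n → ℕ) i - 1)) =
      a * b i / c i * lauricellaTerm (a + 1) (fun j => b j + if j = i then 1 else 0)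
        (fun j => c j + if j = i then 1 else 0) (Function.update z i t) q := by
  have hsum : ∑ k, (q + Pi.single i 1 : Fin n → ℕ) k = ∑ k, q k + 1 := by
    simp [sum_add_distrib]
  have hprod : ∏ k ∈ univ.erase i, poch (b k) ((q + Pi.single i 1 : Fin n → ℕ) k) /
        poch (c k) ((q + Pi.single i 1 : Fin n → ℕ) k) * Function.update z i 1 k ^ (q + Pi.single i 1 : Fin n → ℕ) k /
        (((q + Pi.single i 1 : Fin n → ℕ) k).factorial : ℝ) =
      ∏ k ∈ univ.erase i, poch (b k + if k = i then 1 else 0) (q k) /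
        poch (c k + if k = i then 1 else 0) (q k) * Function.update z i t k ^ q k /
        ((q k).factorial : ℝ) := by
    refine prod_congr rfl fun k hk => ?_
    have hk' := ne_of_mem_erase hk
    simp [hk']
  have hi : (q + Pi.single i 1 : Fin n → ℕ) i = q i + 1 := by simp
  have hq : ((q i : ℝ) + 1) ≠ 0 := by positivity
  have hf : ((q i).factorial : ℝ) ≠ 0 := Nat.cast_ne_zero.2 (Nat.factorial_ne_zero _)
  rw [lauricellaTerm, lauricellaTerm, ← mul_prod_erase _ _ (mem_univ i),
    ← mul_prod_erase _ _ (mem_univ i), hprod, hsum, hi]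
  simp only [Function.update_self, if_true, poch_succ_left, Nat.factorial_succ, Nat.cast_mul,
    Nat.cast_add, Nat.cast_one, one_pow, Nat.add_sub_cancel]
  rw [mul_div_mul_comm (b i)]
  field_simp

theorem add_single_injective {n : ℕ} (i : Fin n) :
    Function.Injective fun q : Fin n → ℕ => q + Pi.single i 1 :=
  add_left_injective _

theorem eq_zero_of_notMem_range_add_single {n : ℕ} {i : Fin n} {p : Fin n → ℕ}
    (hp : p ∉ Set.range fun q : Fin n → ℕ => q + Pi.single i 1) : p i = 0 := by
  by_contra h
  refine hp ⟨p - Pi.single i 1, tsub_add_cancel_of_le ?_⟩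
  intro k
  by_cases hk : k = i
  · subst hk
    simpa using Nat.one_le_iff_ne_zero.2 h
  · simp [hk]

/-- Termwise differentiation in `z_i` yields the series with shifted parameters. -/
theorem hasSum_lauricellaTerm_deriv {n : ℕ} (a : ℝ) (b c : Fin n → ℝ) (i : Fin n) {z : Fin n → ℝ} {t : ℝ}
    (hz : ∑ k, |Function.update z i t k| < 1) :
    HasSum (fun p : Fin n → ℕ =>
        lauricellaTerm a b c (Function.update z i 1) p * (p i * t ^ (p i - 1)))
      (a * b i / c i * lauricella (a + 1) (fun j => b j + if j = i then 1 else 0)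
        (fun j => c j + if j = i then 1 else 0) (Function.update z i t)) := by
  rw [← (add_single_injective i).hasSum_iff fun p hp => by
    simp [eq_zero_of_notMem_range_add_single hp]]
  refine (((summable_lauricellaTerm (a + 1) (fun j => b j + if j = i then 1 else 0)
    (fun j => c j + if j = i then 1 else 0) hz).hasSum).mul_left (a * b i / c i)).congr_fun ?_
  exact fun q => lauricellaTerm_add_single a b c z i t q

/-- formula (34): on the region `|z_1| + ⋯ + |z_n| < 1`, the Lauricella
function is partially differentiable in `z_i` with
`∂F_A/∂z_i = (a b_i / c_i) · F_A(a+1; …, b_i+1, …; …, c_i+1, …; z)`. -/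
theorem lauricella_hasDerivAt (n : ℕ) (hn : 1 ≤ n) (a : ℝ) (b c : Fin n → ℝ)
    (hc : ∀ k, NotNonposInt (c k)) (i : Fin n) (z : Fin n → ℝ) (hz : ∑ k, |z k| < 1) :
    HasDerivAt (fun t => lauricella a b c (Function.update z i t))
      (a * b i / c i *
        lauricella (a + 1) (fun j => b j + if j = i then 1 else 0)
          (fun j => c j + if j = i then 1 else 0) z)
      (z i) := by
  have hS : ∀ t : ℝ, ∑ k, |Function.update z i t k| = |t| + (∑ k, |z k| - |z i|) := fun t => by
    rw [← add_sum_erase _ _ (mem_univ i), ← add_sum_erase _ (fun k => |z k|) (mem_univ i),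
      Function.update_self, add_sub_cancel_left]
    congr 1
    exact sum_congr rfl fun k hk => by rw [Function.update_of_ne (ne_of_mem_erase hk)]
  obtain ⟨r, hr, hr1⟩ : ∃ r, |z i| < r ∧ r < 1 - (∑ k, |z k| - |z i|) :=
    exists_between (by linarith)
  have hr0 : 0 ≤ r := (abs_nonneg _).trans hr.le
  have hder := fun t ht => hasSum_lauricellaTerm_deriv a b c i (z := z) (t := t) ht
  have hbound := (hder r (by rw [hS, abs_of_nonneg hr0]; linarith)).summable.norm
  have hmem : z i ∈ Metric.ball (0 : ℝ) r := by simpa using hr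
  have hmain := hasDerivAt_tsum_of_isPreconnected hbound Metric.isOpen_ball
    (convex_ball (0 : ℝ) r).isPreconnected
    (g := fun p t => lauricellaTerm a b c (Function.update z i t) p)
    (g' := fun p t => lauricellaTerm a b c (Function.update z i 1) p * (p i * t ^ (p i - 1)))
    (fun p t _ => by
      refine ((hasDerivAt_pow (p i) t).const_mul
        (lauricellaTerm a b c (Function.update z i 1) p)).congr_of_eventuallyEq ?_
      exact Eventually.of_forall fun s => lauricellaTerm_update a b c z i s p)
    (fun p t ht => by
      have ht' : |t| ≤ r := by simpa using (mem_ball_zero_iff.1 ht).le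
      simp only [norm_mul, norm_pow, Real.norm_eq_abs, abs_of_nonneg hr0]
      gcongr)
    hmem (by simpa using summable_lauricellaTerm a b c hz) hmem
  rw [(hder (z i) (by simpa using hz)).tsum_eq, Function.update_eq_self] at hmain
  exact hmain
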